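/- Let U be a consistent set of affine equations and C a non-tautological linear clause. Then ⟨C⟩ ⊆ span(U) if and only if no assignment satisfies C together with all equations of U; that is, unit propagation on C from U deduces the contradiction 𝟏 if and only if C ∧ U is unsatisfiable. -/

import Mathlib

namespace XorSAT

/-- An affine equation over `n` Boolean variables: the coefficients of the `n`
variables together with a right-hand side, i.e. a vector in `F₂^(n+1)`. -/
abbrev Eqn (n : ℕ) : Type := (Fin n → ZMod 2) × ZMod 2

/-- The equation `𝟏`, i.e. `0 = 1`, satisfied by no assignment. -/
def oneEq (n : ℕ) : Eqn n := (0, 1)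

/-- An assignment `x` satisfies the equation `(a, b)` iff `∑ aᵢ xᵢ = b`. -/
def Sats {n : ℕ} (x : Fin n → ZMod 2) (e : Eqn n) : Prop :=
  (∑ i, e.1 i * x i) = e.2

/-- A linear clause: a (finite) disjunction of affine equations. -/
abbrev Clause (n : ℕ) : Type := Finset (Eqn n)

/-- An assignment satisfies a linear clause iff it satisfies some equation in it. -/
def SatsClause {n : ℕ} (x : Fin n → ZMod 2) (C : Clause n) : Prop :=
  ∃ e ∈ C, Sats x e

/-- A clause is non-tautological if some assignment falsifies every equation of it. -/
def NonTaut {n : ℕ} (C : Clause n) : Prop :=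
  ∃ x : Fin n → ZMod 2, ∀ e ∈ C, ¬ Sats x e

/-- The linear negation `⟨C⟩` of a clause `C = f₁ ∨ … ∨ f_m`:
the `F₂`-span of `f₁ + 𝟏, …, f_m + 𝟏`. -/
def linneg {n : ℕ} (C : Clause n) : Submodule (ZMod 2) (Eqn n) :=
  Submodule.span (ZMod 2) ((fun e => e + oneEq n) '' (C : Set (Eqn n)))

/-- A set of equations is consistent if some assignment satisfies all of them. -/
def Consistent {n : ℕ} (U : Set (Eqn n)) : Prop :=
  ∃ x : Fin n → ZMod 2, ∀ e ∈ U, Sats x e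

/-- The `F₂`-linear span of a set of equations, as a submodule. -/
def spn {n : ℕ} (U : Set (Eqn n)) : Submodule (ZMod 2) (Eqn n) :=
  Submodule.span (ZMod 2) U


/-- Evaluation of an equation `(a, b)` at `x`, i.e. `∑ aᵢ xᵢ - b`, as a linear functional. -/
def residual {n : ℕ} (x : Fin n → ZMod 2) : Eqn n →ₗ[ZMod 2] ZMod 2 :=
  (Fintype.linearCombination (ZMod 2) x).comp (LinearMap.fst _ _ _) - LinearMap.snd _ _ _

theorem residual_apply {n : ℕ} (x : Fin n → ZMod 2) (e : Eqn n) :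
    residual x e = (∑ i, e.1 i * x i) - e.2 := by
  simp [residual, Fintype.linearCombination_apply]

theorem sats_iff_residual_eq_zero {n : ℕ} (x : Fin n → ZMod 2) (e : Eqn n) :
    Sats x e ↔ residual x e = 0 := by
  rw [residual_apply, sub_eq_zero, Sats]

theorem sats_add_oneEq_iff {n : ℕ} (x : Fin n → ZMod 2) (e : Eqn n) :
    Sats x (e + oneEq n) ↔ ¬ Sats x e := by
  simp only [Sats, oneEq, Prod.fst_add, Prod.snd_add, add_zero]
  generalize (∑ i, e.1 i * x i) = s
  generalize e.2 = b
  revert s b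
  decide

theorem Sats.of_mem_spn {n : ℕ} {U : Set (Eqn n)} {x : Fin n → ZMod 2}
    (hx : ∀ e ∈ U, Sats x e) {g : Eqn n} (hg : g ∈ spn U) : Sats x g := by
  have hle : spn U ≤ LinearMap.ker (residual x) :=
    Submodule.span_le.2 fun e he => (sats_iff_residual_eq_zero x e).1 (hx e he)
  exact (sats_iff_residual_eq_zero x g).2 (hle hg)

/-- Every linear functional on equations is `(a, b) ↦ ∑ aᵢ yᵢ + b c`. -/
theorem exists_dual_apply_eq {n : ℕ} (φ : Eqn n →ₗ[ZMod 2] ZMod 2) :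
    ∃ (y : Fin n → ZMod 2) (c : ZMod 2), ∀ e : Eqn n, φ e = (∑ i, e.1 i * y i) + e.2 * c := by
  refine ⟨fun i => φ (fun j => if i = j then 1 else 0, 0), φ (0, 1), fun e => ?_⟩
  have h₁ : φ (e.1, 0) = ∑ i, e.1 i * φ (fun j => if i = j then 1 else 0, 0) := by
    simpa using (φ.comp (LinearMap.inl _ _ _)).pi_apply_eq_sum_univ e.1
  have h₂ : φ (0, e.2) = e.2 * φ (0, 1) := by
    rw [← smul_eq_mul, ← map_smul]
    simp
  rw [← h₁, ← h₂, ← map_add]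
  simp

/-- An equation implied by a consistent set of equations lies in its span. -/
theorem mem_spn_of_forall_sats {n : ℕ} {U : Set (Eqn n)} (hU : Consistent U) {g : Eqn n}
    (hg : ∀ x : Fin n → ZMod 2, (∀ e ∈ U, Sats x e) → Sats x g) : g ∈ spn U := by
  by_contra hmem
  obtain ⟨φ, hφg, hφU⟩ := Submodule.exists_le_ker_of_notMem hmem
  have hφ : ∀ e ∈ U, φ e = 0 := fun e he => hφU (Submodule.subset_span he)
  obtain ⟨y, c, hyc⟩ := exists_dual_apply_eq φ
  obtain rfl | rfl : c = 0 ∨ c = 1 := (by decide : ∀ c : ZMod 2, c = 0 ∨ c = 1) c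
  · obtain ⟨x, hx⟩ := hU
    have key : ∀ e : Eqn n, residual (x + y) e = residual x e + φ e := by
      intro e
      simp only [residual_apply, hyc, Pi.add_apply, mul_add, Finset.sum_add_distrib]
      ring
    have hxy := hg (x + y) fun e he => by
      rw [sats_iff_residual_eq_zero, key, hφ e he, (sats_iff_residual_eq_zero x e).1 (hx e he),
        add_zero]
    rw [sats_iff_residual_eq_zero, key, (sats_iff_residual_eq_zero x g).1 (hg x hx),
      zero_add] at hxy
    exact hφg hxy
  · have key : ∀ e : Eqn n, φ e = residual y e := by
      intro e
      rw [hyc, residual_apply, mul_one, CharTwo.sub_eq_add]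
    have hy := hg y fun e he => by rw [sats_iff_residual_eq_zero, ← key, hφ e he]
    rw [sats_iff_residual_eq_zero, ← key] at hy
    exact hφg hy

/-- For consistent `U` and non-tautological `C`:
unit propagation on `C` from `U` deduces the contradiction `𝟏`
(i.e. `⟨C⟩ ⊆ span U`) iff `C ∧ U` is unsatisfiable. -/
theorem stmt7 {n : ℕ} (U : Set (Eqn n)) (hU : Consistent U)
    (C : Clause n) (hC : NonTaut C) :
    linneg C ≤ spn U ↔
      ¬ ∃ x : Fin n → ZMod 2, SatsClause x C ∧ ∀ e ∈ U, Sats x e := by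
  constructor
  · rintro h ⟨x, ⟨e, he, hxe⟩, hx⟩
    have hmem : e + oneEq n ∈ linneg C := Submodule.subset_span ⟨e, he, rfl⟩
    exact (sats_add_oneEq_iff x e).1 (Sats.of_mem_spn hx (h hmem)) hxe
  · intro h
    refine Submodule.span_le.2 ?_
    rintro _ ⟨e, he, rfl⟩
    exact mem_spn_of_forall_sats hU fun x hx =>
      (sats_add_oneEq_iff x e).2 fun hxe => h ⟨x, ⟨e, he, hxe⟩, hx⟩

end XorSAT
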